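/- Fix a unit μ ∈ k^×. Under the identification of the endomorphism algebra A^{(n)}(1,1) with the free associative k-algebra on the generators a_{ij} (1 ≤ i ≠ j ≤ n), the automorphisms of A^{(n)}(1,1) induced by the μ-central GMV action of B_n on A^{(n)} (which fixes the object 1) are given by the Humphries–Magnus formulas: σ_k sends a_{ki} ↦ a_{k+1,i} − a_{k+1,k}a_{ki} and a_{ik} ↦ a_{i,k+1} − a_{ik}a_{k,k+1} for i ≠ k, k+1; a_{k+1,i} ↦ a_{ki} and a_{i,k+1} ↦ a_{ik} for i ≠ k, k+1; a_{k,k+1} ↦ −a_{k+1,k}; a_{k+1,k} ↦ −a_{k,k+1}; and a_{ij} ↦ a_{ij} for i, j ≠ k, k+1. In particular, these formulas define algebra automorphisms of the free associative k-algebra on {a_{ij} : i ≠ j} satisfying the braid relations, i.e., a left B_n-action. -/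

import Mathlib

/-!
STATEMENT 9: Under the identification of A^{(n)}(1,1) with the free associative
k-algebra on the generators a_{ij} (i ≠ j), the automorphisms induced by the
μ-central GMV action of B_n are given by the Humphries–Magnus formulas; in
particular these formulas define algebra automorphisms of the free algebra
satisfying the braid relations, i.e., a left B_n-action.
-/

/-- The braid relations among the generators `σ_1, …, σ_m` (indexed by `Fin m`). -/
def braidRels (m : ℕ) : Set (FreeGroup (Fin m)) :=
  {r | (∃ i j : Fin m, (i : ℕ) + 1 = (j : ℕ) ∧
          r = FreeGroup.of i * FreeGroup.of j * FreeGroup.of i *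
              (FreeGroup.of j * FreeGroup.of i * FreeGroup.of j)⁻¹) ∨
       (∃ i j : Fin m, (i : ℕ) + 2 ≤ (j : ℕ) ∧
          r = FreeGroup.of i * FreeGroup.of j * (FreeGroup.of i)⁻¹ * (FreeGroup.of j)⁻¹)}

/-- The braid group `B_n` on `n` strands. -/
abbrev BraidGroup (n : ℕ) : Type := PresentedGroup (braidRels (n - 1))

/-- The standard generator `σ_i` of `B_n`. -/
def braidGen {n : ℕ} (i : Fin (n - 1)) : BraidGroup n := PresentedGroup.of i

/-- Generators of the `k`-category `A^{(n)}` with two objects `{0,1}` (encoded as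
a `k`-algebra with idempotents `e₀, e₁`): the identities `e₀, e₁` and the arrows
`a_i : 1 → 0`, `a_i^* : 0 → 1`. -/
inductive PGen (n : ℕ) : Type
  | e0 : PGen n
  | e1 : PGen n
  | a : Fin n → PGen n
  | as : Fin n → PGen n

variable (k : Type) [CommRing k]

/-- The defining relations of `A^{(n)}`: `e₀, e₁` are orthogonal idempotents
summing to `1` (encoding the two objects), the arrows are placed in the correct
hom-components (`a_i = e₀ a_i e₁`, `a_i^* = e₁ a_i^* e₀`), and the μ-central
relations `a_i^* a_i = (μ − 1) e₁` hold. -/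
inductive PRel (μ : k) (n : ℕ) : FreeAlgebra k (PGen n) → FreeAlgebra k (PGen n) → Prop
  | idem0 : PRel μ n (FreeAlgebra.ι k PGen.e0 * FreeAlgebra.ι k PGen.e0) (FreeAlgebra.ι k PGen.e0)
  | idem1 : PRel μ n (FreeAlgebra.ι k PGen.e1 * FreeAlgebra.ι k PGen.e1) (FreeAlgebra.ι k PGen.e1)
  | orth01 : PRel μ n (FreeAlgebra.ι k PGen.e0 * FreeAlgebra.ι k PGen.e1) 0
  | orth10 : PRel μ n (FreeAlgebra.ι k PGen.e1 * FreeAlgebra.ι k PGen.e0) 0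
  | esum : PRel μ n (FreeAlgebra.ι k PGen.e0 + FreeAlgebra.ι k PGen.e1) 1
  | aL (i : Fin n) :
      PRel μ n (FreeAlgebra.ι k PGen.e0 * FreeAlgebra.ι k (PGen.a i)) (FreeAlgebra.ι k (PGen.a i))
  | aR (i : Fin n) :
      PRel μ n (FreeAlgebra.ι k (PGen.a i) * FreeAlgebra.ι k PGen.e1) (FreeAlgebra.ι k (PGen.a i))
  | asL (i : Fin n) :
      PRel μ n (FreeAlgebra.ι k PGen.e1 * FreeAlgebra.ι k (PGen.as i)) (FreeAlgebra.ι k (PGen.as i))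
  | asR (i : Fin n) :
      PRel μ n (FreeAlgebra.ι k (PGen.as i) * FreeAlgebra.ι k PGen.e0) (FreeAlgebra.ι k (PGen.as i))
  | mu (i : Fin n) :
      PRel μ n (FreeAlgebra.ι k (PGen.as i) * FreeAlgebra.ι k (PGen.a i))
        ((μ - 1) • FreeAlgebra.ι k PGen.e1)

/-- The `k`-category `A^{(n)}` (the μ-central quotient with two objects `{0,1}`),
encoded as a `k`-algebra with idempotents: the `n`-fold coproduct of copies of
`A = A^{(1)}` in the category of `k`-categories with object set `{0,1}`. -/
abbrev PAlg (μ : k) (n : ℕ) : Type := RingQuot (PRel k μ n)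

/-- The idempotent `e₀` (identity of the object `0`). -/
noncomputable def e0P (μ : k) (n : ℕ) : PAlg k μ n :=
  RingQuot.mkAlgHom k (PRel k μ n) (FreeAlgebra.ι k PGen.e0)

/-- The idempotent `e₁` (identity of the object `1`). -/
noncomputable def e1P (μ : k) (n : ℕ) : PAlg k μ n :=
  RingQuot.mkAlgHom k (PRel k μ n) (FreeAlgebra.ι k PGen.e1)

/-- The generating morphism `a_i : 1 → 0`. -/
noncomputable def aP (μ : k) (n : ℕ) (i : Fin n) : PAlg k μ n :=
  RingQuot.mkAlgHom k (PRel k μ n) (FreeAlgebra.ι k (PGen.a i))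

/-- The generating morphism `a_i^* : 0 → 1`. -/
noncomputable def asP (μ : k) (n : ℕ) (i : Fin n) : PAlg k μ n :=
  RingQuot.mkAlgHom k (PRel k μ n) (FreeAlgebra.ι k (PGen.as i))

/-- The invertible endomorphism `T_i = e₀ + a_i a_i^*` of the object `0`. -/
noncomputable def TP (μ : k) (n : ℕ) (i : Fin n) : PAlg k μ n :=
  e0P k μ n + aP k μ n i * asP k μ n i

/-- The inverse `T_i^{-1} = e₀ − μ^{-1} a_i a_i^*` of `T_i` (for `μ` a unit). -/
noncomputable def TinvP (μ : kˣ) (n : ℕ) (i : Fin n) : PAlg k (μ : k) n :=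
  e0P k (μ : k) n - ((μ⁻¹ : kˣ) : k) • (aP k (μ : k) n i * asP k (μ : k) n i)

/-- The strand `i` (as an index in `Fin n`). -/
def lo {n : ℕ} (i : Fin (n - 1)) : Fin n := ⟨i.1, by have := i.isLt; omega⟩
/-- The strand `i+1` (as an index in `Fin n`). -/
def hi {n : ℕ} (i : Fin (n - 1)) : Fin n := ⟨i.1 + 1, by have := i.isLt; omega⟩

/-- The μ-central GMV assignments for the generator `σ_i` acting on `A^{(n)}`:
it fixes both objects `0` and `1` and sends `a_i ↦ T_i a_{i+1}`, `a_{i+1} ↦ a_i`,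
`a_i^* ↦ a_{i+1}^* T_i^{-1}`, `a_{i+1}^* ↦ a_i^*`, fixing `a_j, a_j^*` for
`j ≠ i, i+1`. -/
def IsMuGMVAt (μ : kˣ) (n : ℕ) (i : Fin (n - 1))
    (σ : PAlg k (μ : k) n → PAlg k (μ : k) n) : Prop :=
  σ (e0P k (μ : k) n) = e0P k (μ : k) n ∧
  σ (e1P k (μ : k) n) = e1P k (μ : k) n ∧
  σ (aP k (μ : k) n (lo i)) = TP k (μ : k) n (lo i) * aP k (μ : k) n (hi i) ∧
  σ (aP k (μ : k) n (hi i)) = aP k (μ : k) n (lo i) ∧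
  σ (asP k (μ : k) n (lo i)) = asP k (μ : k) n (hi i) * TinvP k μ n (lo i) ∧
  σ (asP k (μ : k) n (hi i)) = asP k (μ : k) n (lo i) ∧
  (∀ j : Fin n, j ≠ lo i → j ≠ hi i →
    σ (aP k (μ : k) n j) = aP k (μ : k) n j ∧ σ (asP k (μ : k) n j) = asP k (μ : k) n j)

/-- The free associative `k`-algebra on the generators `a_{ij}` (`i ≠ j`). -/
abbrev FreeA (n : ℕ) : Type := FreeAlgebra k {p : Fin n × Fin n // p.1 ≠ p.2}

/-- The generator `a_{ij}` of `FreeA`. -/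
noncomputable def genA (n : ℕ) (i j : Fin n) (h : i ≠ j) : FreeA k n :=
  FreeAlgebra.ι k ⟨(i, j), h⟩

/-- For `i < j`: `a_{ij} = A_{ij} = −a_i^* a_j`; for `i > j`:
`a_{ij} = −μ⁻¹ A_{ij} = μ⁻¹ a_i^* a_j`. The identification of stmt 8. -/
def IsCornerIdent (μ : kˣ) (n : ℕ) (ψ : FreeA k n →ₙₐ[k] PAlg k (μ : k) n) : Prop :=
  ψ 1 = e1P k (μ : k) n ∧
  (∀ p : {p : Fin n × Fin n // p.1 ≠ p.2},
    ψ (FreeAlgebra.ι k p) =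
      if p.1.1 < p.1.2 then -(asP k (μ : k) n p.1.1 * aP k (μ : k) n p.1.2)
      else ((μ⁻¹ : kˣ) : k) • (asP k (μ : k) n p.1.1 * aP k (μ : k) n p.1.2)) ∧
  Function.Injective ψ ∧
  Set.range ψ = {z : PAlg k (μ : k) n | e1P k (μ : k) n * z * e1P k (μ : k) n = z}

/-- `lo i ≠ hi i`. -/
theorem lo_ne_hi {n : ℕ} (i : Fin (n - 1)) : lo i ≠ hi i := by
  simp only [lo, hi, Ne, Fin.mk.injEq]
  omega

/-- The Humphries–Magnus assignments for the generator `σ_K`: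
`a_{Ki} ↦ a_{K+1,i} − a_{K+1,K}a_{Ki}`, `a_{iK} ↦ a_{i,K+1} − a_{iK}a_{K,K+1}`,
`a_{K+1,i} ↦ a_{Ki}`, `a_{i,K+1} ↦ a_{iK}` (for `i ≠ K, K+1`),
`a_{K,K+1} ↦ −a_{K+1,K}`, `a_{K+1,K} ↦ −a_{K,K+1}`, and `a_{ij} ↦ a_{ij}` for
`i, j ≠ K, K+1`. -/
def IsHMAt (n : ℕ) (K : Fin (n - 1)) (H : FreeA k n → FreeA k n) : Prop :=
  (∀ (i : Fin n) (h0 : i ≠ lo K) (h1 : i ≠ hi K),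
    H (genA k n (lo K) i (Ne.symm h0)) =
      genA k n (hi K) i (Ne.symm h1) - genA k n (hi K) (lo K) (Ne.symm (lo_ne_hi K)) *
        genA k n (lo K) i (Ne.symm h0) ∧
    H (genA k n i (lo K) h0) =
      genA k n i (hi K) h1 - genA k n i (lo K) h0 * genA k n (lo K) (hi K) (lo_ne_hi K) ∧
    H (genA k n (hi K) i (Ne.symm h1)) = genA k n (lo K) i (Ne.symm h0) ∧
    H (genA k n i (hi K) h1) = genA k n i (lo K) h0) ∧
  H (genA k n (lo K) (hi K) (lo_ne_hi K)) =
    -genA k n (hi K) (lo K) (Ne.symm (lo_ne_hi K)) ∧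
  H (genA k n (hi K) (lo K) (Ne.symm (lo_ne_hi K))) =
    -genA k n (lo K) (hi K) (lo_ne_hi K) ∧
  (∀ (i j : Fin n) (hij : i ≠ j),
    i ≠ lo K → i ≠ hi K → j ≠ lo K → j ≠ hi K →
      H (genA k n i j hij) = genA k n i j hij)

/-- The generator `a_{ij}` of the free algebra, extended by `0` to the diagonal. -/
noncomputable def genTot (n : ℕ) (i j : Fin n) : FreeA k n :=
  if h : i ≠ j then genA k n i j h else 0

theorem genA_eq_genTot (n : ℕ) (i j : Fin n) (h : i ≠ j) : genA k n i j h = genTot k n i j := by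
  simp [genTot, h]

/-- The Humphries–Magnus endomorphism attached to an ordered pair of indices `(p, q)`;
the generator `σ_K` corresponds to `(K, K+1)` and its inverse to `(K+1, K)`. -/
noncomputable def hmHom (n : ℕ) (p q : Fin n) : FreeA k n →ₐ[k] FreeA k n :=
  FreeAlgebra.lift k fun x =>
    if x.1.1 = p then
      if x.1.2 = q then -genTot k n q p
      else genTot k n q x.1.2 - genTot k n q p * genTot k n p x.1.2
    else if x.1.1 = q then
      if x.1.2 = p then -genTot k n p q else genTot k n p x.1.2
    else if x.1.2 = p then genTot k n x.1.1 q - genTot k n x.1.1 p * genTot k n p q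
    else if x.1.2 = q then genTot k n x.1.1 p
    else genTot k n x.1.1 x.1.2

theorem hmHom_genTot {n : ℕ} (p q : Fin n) {i j : Fin n} (h : i ≠ j) :
    hmHom k n p q (genTot k n i j) =
      if i = p then
        if j = q then -genTot k n q p
        else genTot k n q j - genTot k n q p * genTot k n p j
      else if i = q then
        if j = p then -genTot k n p q else genTot k n p j
      else if j = p then genTot k n i q - genTot k n i p * genTot k n p q
      else if j = q then genTot k n i p
      else genTot k n i j := by
  conv_lhs => rw [← genA_eq_genTot k n i j h]
  rw [hmHom, genA, FreeAlgebra.lift_ι_apply]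

theorem freeA_hom_ext {n : ℕ} {f g : FreeA k n →ₐ[k] FreeA k n}
    (h : ∀ i j : Fin n, i ≠ j → f (genTot k n i j) = g (genTot k n i j)) : f = g := by
  refine FreeAlgebra.hom_ext (funext fun x => ?_)
  have := h x.1.1 x.1.2 x.2
  rwa [← genA_eq_genTot k n _ _ x.2] at this

theorem hmHom_comp_swap {n : ℕ} {p q : Fin n} (h : p ≠ q) :
    (hmHom k n p q).comp (hmHom k n q p) = AlgHom.id k _ := by
  refine freeA_hom_ext k fun i j hij => ?_
  have h' := h.symm
  by_cases hip : i = p <;> by_cases hiq : i = q <;> by_cases hjp : j = p <;>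
    by_cases hjq : j = q <;> subst_vars <;>
    simp_all [hmHom_genTot, Ne.symm, eq_comm]

theorem hmHom_braid {n : ℕ} {p q r : Fin n} (hpq : p ≠ q) (hqr : q ≠ r) (hpr : p ≠ r) :
    (hmHom k n p q).comp ((hmHom k n q r).comp (hmHom k n p q)) =
      (hmHom k n q r).comp ((hmHom k n p q).comp (hmHom k n q r)) := by
  refine freeA_hom_ext k fun i j hij => ?_
  have hqp := hpq.symm
  have hrq := hqr.symm
  have hrp := hpr.symm
  have hcases : ∀ x : Fin n, x = p ∨ x = q ∨ x = r ∨ (x ≠ p ∧ x ≠ q ∧ x ≠ r) := by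
    intro x; tauto
  rcases hcases i with rfl | rfl | rfl | ⟨hip, hiq, hir⟩ <;>
    rcases hcases j with rfl | rfl | rfl | ⟨hjp, hjq, hjr⟩ <;>
    first
    | exact absurd rfl hij
    | (simp [*, hmHom_genTot, Ne.symm]; done)
    | (simp [*, hmHom_genTot, Ne.symm]; noncomm_ring)

theorem hmHom_comm {n : ℕ} {p q r s : Fin n} (hpq : p ≠ q) (hpr : p ≠ r) (hps : p ≠ s)
    (hqr : q ≠ r) (hqs : q ≠ s) (hrs : r ≠ s) :
    (hmHom k n p q).comp (hmHom k n r s) = (hmHom k n r s).comp (hmHom k n p q) := by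
  refine freeA_hom_ext k fun i j hij => ?_
  have hqp := hpq.symm
  have hrp := hpr.symm
  have hsp := hps.symm
  have hrq := hqr.symm
  have hsq := hqs.symm
  have hsr := hrs.symm
  have hcases : ∀ x : Fin n, x = p ∨ x = q ∨ x = r ∨ x = s ∨
      (x ≠ p ∧ x ≠ q ∧ x ≠ r ∧ x ≠ s) := by
    intro x; tauto
  rcases hcases i with rfl | rfl | rfl | rfl | ⟨hip, hiq, hir, his⟩ <;>
    rcases hcases j with rfl | rfl | rfl | rfl | ⟨hjp, hjq, hjr, hjs⟩ <;>
    first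
    | exact absurd rfl hij
    | (simp [*, hmHom_genTot, Ne.symm]; done)
    | (simp [*, hmHom_genTot, Ne.symm]; noncomm_ring)

/-- The Humphries–Magnus automorphism attached to an ordered pair of distinct indices. -/
noncomputable def hmEquiv {n : ℕ} {p q : Fin n} (h : p ≠ q) : FreeA k n ≃ₐ[k] FreeA k n :=
  AlgEquiv.ofAlgHom (hmHom k n p q) (hmHom k n q p) (hmHom_comp_swap k h)
    (hmHom_comp_swap k h.symm)

theorem hmEquiv_apply {n : ℕ} {p q : Fin n} (h : p ≠ q) (x : FreeA k n) :
    hmEquiv k h x = hmHom k n p q x := rfl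

theorem isHMAt_hmEquiv {n : ℕ} (K : Fin (n - 1)) : IsHMAt k n K (hmEquiv k (lo_ne_hi K)) := by
  have h := lo_ne_hi K
  have h' := h.symm
  refine ⟨fun i h0 h1 => ⟨?_, ?_, ?_, ?_⟩, ?_, ?_, fun i j hij _ _ _ _ => ?_⟩ <;>
    simp [*, genA_eq_genTot, hmEquiv_apply, hmHom_genTot, Ne.symm]

theorem hmEquiv_braid {n : ℕ} {i j : Fin (n - 1)} (hij : (i : ℕ) + 1 = j) (x : FreeA k n) :
    hmEquiv k (lo_ne_hi i) (hmEquiv k (lo_ne_hi j) (hmEquiv k (lo_ne_hi i) x)) =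
      hmEquiv k (lo_ne_hi j) (hmEquiv k (lo_ne_hi i) (hmEquiv k (lo_ne_hi j) x)) := by
  have hj : lo j = hi i := Fin.ext hij.symm
  have h1 : lo i ≠ hi j := by simp only [lo, hi, Ne, Fin.mk.injEq]; omega
  have h2 : hi i ≠ hi j := hj ▸ lo_ne_hi j
  simp only [hmEquiv_apply, hj]
  exact DFunLike.congr_fun (hmHom_braid k (lo_ne_hi i) h2 h1) x

theorem hmEquiv_comm {n : ℕ} {i j : Fin (n - 1)} (hij : (i : ℕ) + 2 ≤ j) (x : FreeA k n) :
    hmEquiv k (lo_ne_hi i) (hmEquiv k (lo_ne_hi j) x) =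
      hmEquiv k (lo_ne_hi j) (hmEquiv k (lo_ne_hi i) x) := by
  refine DFunLike.congr_fun (hmHom_comm k (lo_ne_hi i) ?_ ?_ ?_ ?_ (lo_ne_hi j)) x <;>
    simp only [lo, hi, Ne, Fin.mk.injEq] <;> omega

theorem exists_braidGroup_hom (n : ℕ) :
    ∃ ρ : BraidGroup n →* (FreeA k n ≃ₐ[k] FreeA k n),
      ∀ K : Fin (n - 1), ρ (braidGen K) = hmEquiv k (lo_ne_hi K) := by
  refine ⟨PresentedGroup.toGroup (f := fun K => hmEquiv k (lo_ne_hi K)) ?_,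
    fun K => PresentedGroup.toGroup.of _⟩
  rintro r (⟨i, j, hij, rfl⟩ | ⟨i, j, hij, rfl⟩)
  · simp only [map_mul, map_inv, FreeGroup.lift_apply_of, mul_inv_eq_one]
    exact AlgEquiv.ext fun x => hmEquiv_braid k hij x
  · simp only [map_mul, map_inv, FreeGroup.lift_apply_of]
    rw [mul_inv_eq_one, mul_inv_eq_iff_eq_mul]
    exact AlgEquiv.ext fun x => hmEquiv_comm k hij x

section Corner

variable {k} {μ : kˣ} {n : ℕ}

theorem e0P_mul_aP (i : Fin n) : e0P k (μ : k) n * aP k (μ : k) n i = aP k (μ : k) n i := by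
  have h := RingQuot.mkAlgHom_rel k (PRel.aL (μ := (μ : k)) i)
  rwa [map_mul] at h

theorem aP_mul_e1P (i : Fin n) : aP k (μ : k) n i * e1P k (μ : k) n = aP k (μ : k) n i := by
  have h := RingQuot.mkAlgHom_rel k (PRel.aR (μ := (μ : k)) i)
  rwa [map_mul] at h

theorem e1P_mul_asP (i : Fin n) : e1P k (μ : k) n * asP k (μ : k) n i = asP k (μ : k) n i := by
  have h := RingQuot.mkAlgHom_rel k (PRel.asL (μ := (μ : k)) i)
  rwa [map_mul] at h

theorem asP_mul_e0P (i : Fin n) : asP k (μ : k) n i * e0P k (μ : k) n = asP k (μ : k) n i := by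
  have h := RingQuot.mkAlgHom_rel k (PRel.asR (μ := (μ : k)) i)
  rwa [map_mul] at h

theorem asP_mul_aP (i : Fin n) :
    asP k (μ : k) n i * aP k (μ : k) n i = ((μ : k) - 1) • e1P k (μ : k) n := by
  have h := RingQuot.mkAlgHom_rel k (PRel.mu (μ := (μ : k)) i)
  rwa [map_mul, map_smul] at h

theorem asP_mul_TP_mul_aP (i j l : Fin n) :
    asP k (μ : k) n i * (TP k (μ : k) n l * aP k (μ : k) n j) =
      asP k (μ : k) n i * aP k (μ : k) n j +
        asP k (μ : k) n i * aP k (μ : k) n l * (asP k (μ : k) n l * aP k (μ : k) n j) := by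
  rw [TP, add_mul, mul_add, e0P_mul_aP]
  simp only [mul_assoc]

theorem asP_mul_TinvP_mul_aP (i j l : Fin n) :
    asP k (μ : k) n i * TinvP k μ n l * aP k (μ : k) n j =
      asP k (μ : k) n i * aP k (μ : k) n j - ((μ⁻¹ : kˣ) : k) •
        (asP k (μ : k) n i * aP k (μ : k) n l * (asP k (μ : k) n l * aP k (μ : k) n j)) := by
  rw [TinvP, mul_sub, sub_mul, asP_mul_e0P]
  simp only [mul_assoc, mul_smul_comm, smul_mul_assoc]

theorem IsCornerIdent.map_genTot {ψ : FreeA k n →ₙₐ[k] PAlg k (μ : k) n}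
    (hψ : IsCornerIdent k μ n ψ) {i j : Fin n} (h : i ≠ j) :
    ψ (genTot k n i j) = (if i < j then (-1 : k) else ((μ⁻¹ : kˣ) : k)) •
      (asP k (μ : k) n i * aP k (μ : k) n j) := by
  rw [← genA_eq_genTot k n i j h, genA, hψ.2.1]
  split_ifs
  · exact (neg_one_smul k _).symm
  · rfl

theorem map_genTot_of_isMuGMVAt {K : Fin (n - 1)} {σ : PAlg k (μ : k) n ≃ₐ[k] PAlg k (μ : k) n}
    (hσ : IsMuGMVAt k μ n K σ) {ψ : FreeA k n →ₙₐ[k] PAlg k (μ : k) n}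
    (hψ : IsCornerIdent k μ n ψ) {i j : Fin n} (hij : i ≠ j) :
    σ (ψ (genTot k n i j)) = ψ (hmHom k n (lo K) (hi K) (genTot k n i j)) := by
  obtain ⟨-, -, hal, hah, hsl, hsh, hfix⟩ := hσ
  have hlh := lo_ne_hi K
  have hhl := hlh.symm
  have hlt : lo K < hi K := Nat.lt_succ_self K.1
  have hnlt : ¬ hi K < lo K := hlt.not_gt
  have hcases : ∀ x : Fin n, x = lo K ∨ x = hi K ∨ (x ≠ lo K ∧ x ≠ hi K) := by
    intro x; tauto
  have hltl : ∀ x : Fin n, x ≠ lo K → x ≠ hi K → (lo K < x ↔ hi K < x) := by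
    intro x h0 h1
    simp only [lo, hi, Ne, Fin.ext_iff, Fin.lt_def] at *
    omega
  have hltr : ∀ x : Fin n, x ≠ lo K → x ≠ hi K → (x < lo K ↔ x < hi K) := by
    intro x h0 h1
    simp only [lo, hi, Ne, Fin.ext_iff, Fin.lt_def] at *
    omega
  have hμ : ((μ⁻¹ : kˣ) : k) * μ = 1 := μ.inv_mul
  have hL : σ (ψ (genTot k n i j)) = (if i < j then (-1 : k) else ((μ⁻¹ : kˣ) : k)) •
      (σ (asP k (μ : k) n i) * σ (aP k (μ : k) n j)) := by
    rw [hψ.map_genTot hij, map_smul, map_mul]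
  rw [hL, hmHom_genTot k _ _ hij]
  rcases hcases i with rfl | rfl | ⟨hil, hih⟩ <;>
    rcases hcases j with rfl | rfl | ⟨hjl, hjh⟩
  · exact absurd rfl hij
  · rw [if_pos rfl, if_pos rfl, if_pos hlt, hsl, hah, asP_mul_TinvP_mul_aP, map_neg,
      hψ.map_genTot hhl, if_neg hnlt, asP_mul_aP, mul_smul_comm, mul_assoc, aP_mul_e1P]
    match_scalars
    linear_combination hμ
  · rw [if_pos rfl, if_neg hjh, map_sub, map_mul, hψ.map_genTot hjh.symm,
      hψ.map_genTot hjl.symm, hψ.map_genTot hhl, if_neg hnlt, hsl, (hfix j hjl hjh).1,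
      asP_mul_TinvP_mul_aP, smul_mul_smul_comm]
    simp only [hltl j hjl hjh]
    module
  · rw [if_neg hhl, if_pos rfl, if_pos rfl, map_neg, hψ.map_genTot hlh, if_pos hlt, if_neg hnlt,
      hsh, hal, asP_mul_TP_mul_aP, asP_mul_aP, smul_mul_assoc, ← mul_assoc, e1P_mul_asP]
    match_scalars
    linear_combination hμ
  · exact absurd rfl hij
  · rw [if_neg hhl, if_pos rfl, if_neg hjl, hψ.map_genTot hjl.symm, hsh, (hfix j hjl hjh).1]
    simp only [hltl j hjl hjh]
  · rw [if_neg hil, if_neg hih, if_pos rfl, map_sub, map_mul, hψ.map_genTot hih,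
      hψ.map_genTot hil, hψ.map_genTot hlh, if_pos hlt, hal, (hfix i hil hih).2,
      asP_mul_TP_mul_aP, smul_mul_smul_comm]
    simp only [hltr i hil hih]
    module
  · rw [if_neg hil, if_neg hih, if_neg hhl, if_pos rfl, hψ.map_genTot hil, hah, (hfix i hil hih).2]
    simp only [hltr i hil hih]
  · rw [if_neg hil, if_neg hih, if_neg hjl, if_neg hjh, hψ.map_genTot hij, (hfix i hil hih).2,
      (hfix j hjl hjh).1]

theorem map_eq_map_hmEquiv_of_isMuGMVAt {K : Fin (n - 1)}
    {σ : PAlg k (μ : k) n ≃ₐ[k] PAlg k (μ : k) n} (hσ : IsMuGMVAt k μ n K σ)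
    {ψ : FreeA k n →ₙₐ[k] PAlg k (μ : k) n} (hψ : IsCornerIdent k μ n ψ) (x : FreeA k n) :
    σ (ψ x) = ψ (hmEquiv k (lo_ne_hi K) x) := by
  induction x using FreeAlgebra.induction with
  | grade0 r =>
    rw [AlgEquiv.commutes, Algebra.algebraMap_eq_smul_one, map_smul, map_smul, hψ.1, hσ.2.1]
  | grade1 p =>
    have h := map_genTot_of_isMuGMVAt hσ hψ p.2
    rwa [← genA_eq_genTot k n _ _ p.2] at h
  | mul a b ha hb => rw [map_mul, map_mul, ha, hb, map_mul, map_mul]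
  | add a b ha hb => rw [map_add, map_add, ha, hb, map_add, map_add]

end Corner

theorem statement9 (μ : kˣ) (n : ℕ) :
    ∃ HM : Fin (n - 1) → (FreeA k n ≃ₐ[k] FreeA k n),
      -- the Humphries–Magnus formulas define algebra automorphisms …
      (∀ K : Fin (n - 1), IsHMAt k n K (HM K)) ∧
      -- … satisfying the braid relations, i.e., a left B_n-action
      (∀ i j : Fin (n - 1), (i : ℕ) + 1 = (j : ℕ) →
        ∀ x, HM i (HM j (HM i x)) = HM j (HM i (HM j x))) ∧
      (∀ i j : Fin (n - 1), (i : ℕ) + 2 ≤ (j : ℕ) →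
        ∀ x, HM i (HM j x) = HM j (HM i x)) ∧
      (∃ ρ : BraidGroup n →* (FreeA k n ≃ₐ[k] FreeA k n),
        ∀ K : Fin (n - 1), ρ (braidGen K) = HM K) ∧
      -- under the identification ψ of A^{(n)}(1,1) with the free algebra on the
      -- a_{ij}, the automorphisms induced by the μ-central GMV action (which
      -- fixes the object 1) are exactly the HM automorphisms
      (∀ (K : Fin (n - 1)) (σ : PAlg k (μ : k) n ≃ₐ[k] PAlg k (μ : k) n),
        IsMuGMVAt k μ n K (σ : PAlg k (μ : k) n → PAlg k (μ : k) n) →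
        ∀ ψ : FreeA k n →ₙₐ[k] PAlg k (μ : k) n, IsCornerIdent k μ n ψ →
          ∀ x : FreeA k n, σ (ψ x) = ψ (HM K x)) := by
  exact ⟨fun K => hmEquiv k (lo_ne_hi K), isHMAt_hmEquiv k, fun _ _ hij => hmEquiv_braid k hij,
    fun _ _ hij => hmEquiv_comm k hij, exists_braidGroup_hom k n,
    fun _ _ hσ _ hψ => map_eq_map_hmEquiv_of_isMuGMVAt hσ hψ⟩
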